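/- Let f : |P| → |Q| be a weak morphism of precubical sets that is a homeomorphism, A ⊆ Q a precubical subset, and z a top cube of the carrier c(A). Then A⁻_z := {a ∈ A : c(a) ≠ z} is a precubical subset of A, and z ∉ c(A⁻_z). -/

import Mathlib

/-- A graded set with boundary operators: the data of a precubical set.
`cell` is the set of all cubes, `deg` the degree, and `d b i x` the face
`dᵢᵇ x`, meaningful for `1 ≤ i ≤ deg x` (`b = false` is `d⁰`, `b = true` is `d¹`). -/
structure PrecubicalSet where
  cell : Type
  deg : cell → ℕ
  d : Bool → ℕ → cell → cell

/-- `P` is a genuine precubical set: faces lower degree by one and the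
precubical relations `dᵢᵏ ∘ dⱼˡ = dⱼ₋₁ˡ ∘ dᵢᵏ` hold for `i < j`. -/
def PrecubicalSet.IsPrecubical (P : PrecubicalSet) : Prop :=
  (∀ (b : Bool) (i : ℕ) (x : P.cell), 1 ≤ i → i ≤ P.deg x →
      P.deg (P.d b i x) = P.deg x - 1) ∧
  (∀ (b b' : Bool) (i j : ℕ) (x : P.cell), 1 ≤ i → i < j → j ≤ P.deg x →
      P.d b i (P.d b' j x) = P.d b' (j - 1) (P.d b i x))

/-- A precubical subset: a graded subset stable under the boundary operators. -/
def PrecubicalSet.IsSub (P : PrecubicalSet) (X : Set P.cell) : Prop :=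
  ∀ (b : Bool) (i : ℕ) (x : P.cell), 1 ≤ i → i ≤ P.deg x → x ∈ X → P.d b i x ∈ X

/-- A morphism of precubical sets: a degree-preserving map commuting with the
boundary operators (on their meaningful range of indices). -/
structure PrecubicalHom (P Q : PrecubicalSet) where
  map : P.cell → Q.cell
  deg_map : ∀ x, Q.deg (map x) = P.deg x
  d_map : ∀ (b : Bool) (i : ℕ) (x : P.cell), 1 ≤ i → i ≤ P.deg x →
    map (P.d b i x) = Q.d b i (map x)
open CategoryTheory

noncomputable section
open scoped Classical DirectSum

instance (P : PrecubicalSet) : TopologicalSpace P.cell := ⊥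

namespace PrecubicalSet

variable (P : PrecubicalSet)

/-- The disjoint union `⨿ₙ Pₙ × [0,1]ⁿ` (cells carry the discrete topology). -/
def ESpace : Type := Σ x : P.cell, Fin (P.deg x) → unitInterval

instance : TopologicalSpace P.ESpace := by unfold ESpace; infer_instance

/-- The map `δᵢᵇ : [0,1]^m → [0,1]^{m+1}` inserting the coordinate `b` at
position `i` (1-based). -/
def insCoord {m : ℕ} (b : Bool) (i : ℕ) (u : Fin m → unitInterval) :
    Fin (m + 1) → unitInterval :=
  fun j =>
    if (j : ℕ) + 1 < i then (if h : (j : ℕ) < m then u ⟨j, h⟩ else 0)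
    else if (j : ℕ) + 1 = i then (if b then 1 else 0)
    else if h : (j : ℕ) - 1 < m then u ⟨(j : ℕ) - 1, h⟩ else 0

/-- The gluing relation of the geometric realisation:
`(dᵢᵇ x, u) ∼ (x, δᵢᵇ u)`. -/
def RelE : P.ESpace → P.ESpace → Prop := fun a z =>
  ∃ (b : Bool) (i : ℕ), 1 ≤ i ∧ i ≤ P.deg z.1 ∧ a.1 = P.d b i z.1 ∧
    HEq (insCoord b i a.2) z.2

/-- The geometric realisation `|P|` of a precubical set. -/
def GeomReal : Type := Quot P.RelE

instance : TopologicalSpace P.GeomReal := by unfold GeomReal; infer_instance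

/-- The point `[x, u]` of `|P|`. -/
def pt (x : P.cell) (u : Fin (P.deg x) → unitInterval) : P.GeomReal :=
  Quot.mk _ ⟨x, u⟩

end PrecubicalSet

namespace PrecubicalSet

/-- The midpoint `½ ∈ [0,1]`. -/
def half : unitInterval := ⟨1/2, by norm_num⟩

/-- The degree of a cell of the grid: a grid cell assigns to each of the `n`
coordinates either a vertex `j` (`(j, false)`) or an edge `[j, j+1]`
(`(j, true)`); the degree is the number of edge coordinates. -/
def gridDeg {n : ℕ} (c : Fin n → ℕ × Bool) : ℕ :=
  (Finset.univ.filter fun i => (c i).2 = true).card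

/-- The boundary operator of the grid: `dₘᵇ` replaces the `m`-th edge
coordinate `[j, j+1]` by the vertex `j` (`b = false`) or `j+1` (`b = true`). -/
def gridD {n : ℕ} (b : Bool) (m : ℕ) (c : Fin n → ℕ × Bool) : Fin n → ℕ × Bool :=
  fun i =>
    if (c i).2 = true ∧
        (Finset.univ.filter fun i' => (c i').2 = true ∧ i' < i).card + 1 = m
    then ((c i).1 + (if b then 1 else 0), false) else c i

/-- The precubical set `⟦0,k₁⟧ ⊗ ⋯ ⊗ ⟦0,kₙ⟧`. -/
def BoxData {n : ℕ} (k : Fin n → ℕ) : PrecubicalSet where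
  cell := {c : Fin n → ℕ × Bool // ∀ i, (c i).1 + (if (c i).2 then 1 else 0) ≤ k i}
  deg := fun c => gridDeg c.1
  d := fun b m c => ⟨gridD b m c.1, by
    intro i
    dsimp only [gridD]
    split
    · rename_i h
      have h2 := c.2 i
      rw [h.1] at h2
      simp only [if_true] at h2
      cases b <;> simp <;> omega
    · exact c.2 i⟩

/-- The cell of the box `⟦0,k₁⟧ ⊗ ⋯ ⊗ ⟦0,kₙ⟧` in whose relatively open
realisation a point `t ∈ [0,k₁] × ⋯ × [0,kₙ]` lies. -/
noncomputable def cellOf {n : ℕ} (k : Fin n → ℕ)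
    (t : ∀ i, Set.Icc (0:ℝ) (k i : ℝ)) : (BoxData k).cell :=
  ⟨fun i => if ((t i : ℝ) = (⌊(t i : ℝ)⌋ : ℤ))
      then ((⌊(t i : ℝ)⌋).toNat, false) else ((⌊(t i : ℝ)⌋).toNat, true), by
    intro i
    have h1 : ⌊(t i : ℝ)⌋ ≤ (k i : ℤ) := by
      have := Int.floor_mono (t i).2.2
      simpa using this
    have h0 : 0 ≤ ⌊(t i : ℝ)⌋ := Int.floor_nonneg.mpr (t i).2.1
    dsimp only
    split
    · simp only [Bool.false_eq_true, if_false, add_zero]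
      omega
    · rename_i h
      have h2 : (t i : ℝ) < (k i : ℝ) := by
        rcases lt_or_eq_of_le (t i).2.2 with h' | h'
        · exact h'
        · exact absurd (by rw [h']; exact_mod_cast (Int.floor_natCast (k i)).symm) h
      have h3 : ⌊(t i : ℝ)⌋ < (k i : ℤ) := by
        rw [Int.floor_lt]
        exact_mod_cast h2
      simp only [if_true]
      omega⟩

/-- The coordinates of `t` inside the open cell of `cellOf k t`: the fractional
parts of the edge coordinates, in order. -/
noncomputable def uOf {n : ℕ} (k : Fin n → ℕ)
    (t : ∀ i, Set.Icc (0:ℝ) (k i : ℝ)) :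
    Fin ((BoxData k).deg (cellOf k t)) → unitInterval :=
  fun m =>
    ⟨Int.fract ((t ((((Finset.univ.filter
          fun i => (((cellOf k t).1 i).2 = true)).orderIsoOfFin rfl) m : _) : Fin n)) : ℝ),
      Int.fract_nonneg _, (Int.fract_lt_one _).le⟩

variable {P Q : PrecubicalSet}

/-- The image of the point of `|⟦0,k₁⟧ ⊗ ⋯ ⊗ ⟦0,kₙ⟧| = [0,k₁] × ⋯ × [0,kₙ]`
with coordinates `t` under the geometric realisation `|ξ|` of a morphism of
precubical sets `ξ : ⟦0,k₁⟧ ⊗ ⋯ ⊗ ⟦0,kₙ⟧ → P`. -/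
noncomputable def realBox {n : ℕ} {k : Fin n → ℕ}
    (ξ : PrecubicalHom (BoxData k) P) (t : ∀ i, Set.Icc (0:ℝ) (k i : ℝ)) :
    P.GeomReal :=
  P.pt (ξ.map (cellOf k t)) (uOf k t ∘ Fin.cast (ξ.deg_map _))

/-- `f : |P| → |Q|` is a weak morphism of precubical sets: it sends vertices to
vertices, and for every morphism of precubical sets
`ξ : ⟦0,k₁⟧ ⊗ ⋯ ⊗ ⟦0,kₙ⟧ → P` there are a morphism of precubical sets
`χ : ⟦0,l₁⟧ ⊗ ⋯ ⊗ ⟦0,lₙ⟧ → Q` and a dihomeomorphism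
`φ : [0,k₁] × ⋯ × [0,kₙ] → [0,l₁] × ⋯ × [0,lₙ]` with `f ∘ |ξ| = |χ| ∘ φ`. -/
def IsWeakMorphism (f : P.GeomReal → Q.GeomReal) : Prop :=
  (∀ v : P.cell, P.deg v = 0 →
      ∃ w : Q.cell, Q.deg w = 0 ∧
        f (P.pt v fun _ => half) = Q.pt w fun _ => half) ∧
  ∀ (n : ℕ) (k : Fin n → ℕ), (∀ i, 1 ≤ k i) →
    ∀ ξ : PrecubicalHom (BoxData k) P,
      ∃ (l : Fin n → ℕ), (∀ i, 1 ≤ l i) ∧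
        ∃ (χ : PrecubicalHom (BoxData l) Q)
          (φ : (∀ i, Set.Icc (0:ℝ) (k i : ℝ)) ≃ₜ (∀ i, Set.Icc (0:ℝ) (l i : ℝ))),
          (∀ s t, s ≤ t ↔ φ s ≤ φ t) ∧
          ∀ t, f (realBox ξ t) = realBox χ (φ t)

/-- `p ∈ P` is the carrier of `a ∈ Q` with respect to `f : |P| → |Q|`: there is
`u` in the open cube with `f([p,u]) = [a,(½,…,½)]`.  (For a weak morphism that
is a homeomorphism, the carrier of `a` exists and is unique.) -/
def IsCarrier (f : P.GeomReal → Q.GeomReal) (p : P.cell) (a : Q.cell) : Prop :=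
  ∃ u : Fin (P.deg p) → unitInterval,
    (∀ j, (u j : ℝ) ∈ Set.Ioo (0:ℝ) 1) ∧
    f (P.pt p u) = Q.pt a fun _ => half

/-- The precubical subset `x♯(⟦0,1⟧^{⊗ deg x})` generated by a cube `x`:
all iterated faces of `x`. -/
def gen (P : PrecubicalSet) (x : P.cell) : Set P.cell :=
  {y | Relation.ReflTransGen
    (fun a c => ∃ (b : Bool) (i : ℕ), 1 ≤ i ∧ i ≤ P.deg c ∧ a = P.d b i c) y x}

/-- The subset `|X| ⊆ |P|` determined by a precubical subset `X ⊆ P`. -/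
def geomSet (P : PrecubicalSet) (X : Set P.cell) : Set P.GeomReal :=
  {z | ∃ x ∈ X, ∃ u, z = P.pt x u}

/-- The carrier `c(A) = ⋃_{a ∈ A} c(a)♯(⟦0,1⟧^{⊗ deg c(a)})` of a precubical
subset `A ⊆ Q`, where `c` is the carrier function of `f`. -/
def carrierSet (c : Q.cell → P.cell) (A : Set Q.cell) : Set P.cell :=
  {p | ∃ a ∈ A, p ∈ P.gen (c a)}

/-- `z` is a top cube of `S`: `z ∈ S` and `z` is not a proper iterated face of
any element of `S`. -/
def TopCube (P : PrecubicalSet) (S : Set P.cell) (z : P.cell) : Prop :=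
  z ∈ S ∧ ∀ x ∈ S, P.deg z < P.deg x → z ∉ P.gen x

/-- An `n`-cube `x ∈ P` is broken in the precubical subset `A ⊆ Q` (with
respect to `f` with carrier function `c`): `x ∈ c(A)` and
`f(x♯(⟦0,1⟧^{⊗n})) ⊄ A` (on geometric realisations). -/
def Broken (f : P.GeomReal → Q.GeomReal) (c : Q.cell → P.cell)
    (A : Set Q.cell) (x : P.cell) : Prop :=
  x ∈ carrierSet c A ∧ ¬ (f '' P.geomSet (P.gen x) ⊆ Q.geomSet A)

end PrecubicalSet

namespace PrecubicalSet

section NormalForm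

variable {P : PrecubicalSet}

/-- Points of `⨿ₙ Pₙ × [0,1]ⁿ` with their coordinates extended to a sequence. -/
def extendCoord (a : P.ESpace) : P.cell × (ℕ → unitInterval) :=
  (a.1, fun j => if h : j < P.deg a.1 then a.2 ⟨j, h⟩ else half)

/-- Deletion of the `i`-th term of a sequence. -/
def eraseCoord (i : ℕ) (w : ℕ → unitInterval) : ℕ → unitInterval :=
  fun j => if j < i then w j else w (j + 1)

/-- One step of the reduction of a point to its representative in an open cube: a coordinate
equal to `0` or `1` is deleted and the cube is replaced by the corresponding face. -/
def FaceStep (P : PrecubicalSet) (a b : P.cell × (ℕ → unitInterval)) : Prop :=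
  ∃ (e : Bool) (i : ℕ), i < P.deg a.1 ∧ a.2 i = (if e then 1 else 0) ∧
    b = (P.d e (i + 1) a.1, eraseCoord i a.2)

theorem FaceStep.of_relE (hP : P.IsPrecubical) {a z : P.ESpace} (h : P.RelE a z) :
    FaceStep P (extendCoord z) (extendCoord a) := by
  obtain ⟨y, u⟩ := a
  obtain ⟨x, w⟩ := z
  obtain ⟨b, i, hi, hix, hy, hw⟩ := h
  dsimp only at hix hy hw
  subst hy
  have hdeg := hP.1 b i x hi hix
  have key : ∀ (k : ℕ) (w : Fin k → unitInterval), P.deg (P.d b i x) + 1 = k →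
      HEq (insCoord b i u) w → ∀ j (h : j < k) (h' : j < P.deg (P.d b i x) + 1),
        w ⟨j, h⟩ = insCoord b i u ⟨j, h'⟩ := by
    rintro k w rfl hw j h h'
    rw [eq_of_heq hw]
  have hw' := key _ w (by omega) hw
  obtain ⟨i, rfl⟩ : ∃ i', i = i' + 1 := ⟨i - 1, by omega⟩
  refine ⟨b, i, by simpa [extendCoord] using hix, ?_, ?_⟩
  · have : i < P.deg x := hix
    simp only [extendCoord, this, dif_pos]
    rw [hw' i this (by omega)]
    simp [insCoord]
  · refine Prod.ext rfl (funext fun j => ?_)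
    simp only [extendCoord, eraseCoord]
    by_cases hj : j < P.deg (P.d b (i + 1) x)
    · rw [dif_pos hj]
      by_cases hji : j < i
      · rw [if_pos hji, dif_pos (by omega), hw' j (by omega) (by omega)]
        simp [insCoord, hji, hj]
      · rw [if_neg hji, dif_pos (by omega), hw' (j + 1) (by omega) (by omega)]
        have h1 : ¬ (j + 1 < i) := by omega
        have h2 : ¬ (j + 1 = i) := by omega
        simp [insCoord, h1, h2, hj]
    · rw [dif_neg hj, if_neg (by omega), dif_neg (by omega)]

theorem eraseCoord_eraseCoord {i j : ℕ} (h : i ≤ j) (w : ℕ → unitInterval) :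
    eraseCoord i (eraseCoord (j + 1) w) = eraseCoord j (eraseCoord i w) := by
  funext k
  simp only [eraseCoord]
  split_ifs <;> first | rfl | omega

theorem FaceStep.diamond (hP : P.IsPrecubical) {a b c : P.cell × (ℕ → unitInterval)}
    (hb : FaceStep P a b) (hc : FaceStep P a c) :
    b = c ∨ ∃ d, FaceStep P b d ∧ FaceStep P c d := by
  have main : ∀ {a b c : P.cell × (ℕ → unitInterval)} (e e' : Bool) (i j : ℕ), i < j →
      j < P.deg a.1 → a.2 i = (if e then 1 else 0) → a.2 j = (if e' then 1 else 0) →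
      b = (P.d e (i + 1) a.1, eraseCoord i a.2) →
      c = (P.d e' (j + 1) a.1, eraseCoord j a.2) →
      ∃ d, FaceStep P b d ∧ FaceStep P c d := by
    rintro a b c e e' i j hij hj hai haj rfl rfl
    obtain ⟨j, rfl⟩ : ∃ j', j = j' + 1 := ⟨j - 1, by omega⟩
    have hdi := hP.1 e (i + 1) a.1 (by omega) (by omega)
    have hdj := hP.1 e' (j + 1 + 1) a.1 (by omega) (by omega)
    refine ⟨(P.d e' (j + 1) (P.d e (i + 1) a.1), eraseCoord j (eraseCoord i a.2)),
      ⟨e', j, by dsimp only; omega, ?_, rfl⟩, ⟨e, i, by dsimp only; omega, ?_, ?_⟩⟩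
    · simp only [eraseCoord, if_neg (show ¬ j < i by omega)]
      exact haj
    · simp only [eraseCoord, if_pos (show i < j + 1 by omega)]
      exact hai
    · rw [eraseCoord_eraseCoord (by omega),
        hP.2 e e' (i + 1) (j + 1 + 1) a.1 (by omega) (by omega) (by omega)]
      rfl
  obtain ⟨e, i, hi, hai, hb⟩ := hb
  obtain ⟨e', j, hj, haj, hc⟩ := hc
  rcases lt_trichotomy i j with h | h | h
  · exact Or.inr (main e e' i j h hj hai haj hb hc)
  · subst h
    left
    have : e = e' := by
      rw [hai] at haj
      cases e <;> cases e' <;> first | rfl | simp at haj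
    rw [hb, hc, this]
  · obtain ⟨d, h1, h2⟩ := main e' e j i h hi haj hai hc hb
    exact Or.inr ⟨d, h2, h1⟩

theorem join_faceStep_of_mk_eq (hP : P.IsPrecubical) {a b : P.ESpace}
    (h : Quot.mk P.RelE a = Quot.mk P.RelE b) :
    Relation.Join (Relation.ReflTransGen (FaceStep P)) (extendCoord a) (extendCoord b) := by
  have heqv : Equivalence (Relation.Join (Relation.ReflTransGen (FaceStep P))) := by
    refine Relation.equivalence_join_reflTransGen fun a b c hb hc => ?_
    rcases FaceStep.diamond hP hb hc with rfl | ⟨d, h1, h2⟩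
    · exact ⟨b, .refl, .refl⟩
    · exact ⟨d, .single h1, .single h2⟩
  replace h := Quot.eqvGen_exact h
  induction h with
  | rel a b h => exact ⟨_, .refl, .single (FaceStep.of_relE hP h)⟩
  | refl a => exact heqv.refl _
  | symm a b _ ih => exact heqv.symm ih
  | trans a b c _ _ ih ih' => exact heqv.trans ih ih'

theorem not_faceStep_of_mem_Ioo {x : P.cell} {u : Fin (P.deg x) → unitInterval}
    (hu : ∀ j, (u j : ℝ) ∈ Set.Ioo (0 : ℝ) 1) (b : P.cell × (ℕ → unitInterval)) :
    ¬ FaceStep P (extendCoord ⟨x, u⟩) b := by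
  rintro ⟨e, i, hi, h, -⟩
  have hi' : i < P.deg x := hi
  simp only [extendCoord, hi', dif_pos] at h
  have := hu ⟨i, hi'⟩
  rw [h] at this
  cases e <;> simp at this

theorem d_mem_gen {b : Bool} {i : ℕ} {x : P.cell} (h1 : 1 ≤ i) (hi : i ≤ P.deg x) :
    P.d b i x ∈ P.gen x :=
  .single ⟨b, i, h1, hi, rfl⟩

theorem gen_trans {x y w : P.cell} (hx : x ∈ P.gen y) (hy : y ∈ P.gen w) : x ∈ P.gen w :=
  Relation.ReflTransGen.trans hx hy

theorem eq_or_deg_lt_of_mem_gen (hP : P.IsPrecubical) {x y : P.cell} (h : y ∈ P.gen x) :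
    y = x ∨ P.deg y < P.deg x := by
  induction h with
  | refl => exact .inl rfl
  | tail _ h ih =>
    obtain ⟨b, i, h1, hi, rfl⟩ := h
    have := hP.1 b i _ h1 hi
    right
    rcases ih with rfl | ih <;> omega

theorem mem_gen_of_reflTransGen_faceStep {a b : P.cell × (ℕ → unitInterval)}
    (h : Relation.ReflTransGen (FaceStep P) a b) : b.1 ∈ P.gen a.1 := by
  induction h with
  | refl => exact .refl
  | tail _ h ih =>
    obtain ⟨e, i, hi, -, rfl⟩ := h
    exact gen_trans (d_mem_gen (by omega) (by omega)) ih

/-- If a point of the cube `x` lies in the open cube `y`, then `y` is an iterated face of `x`. -/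
theorem mem_gen_of_pt_eq (hP : P.IsPrecubical) {x y : P.cell}
    {u : Fin (P.deg x) → unitInterval} {v : Fin (P.deg y) → unitInterval}
    (h : P.pt x u = P.pt y v) (hv : ∀ j, (v j : ℝ) ∈ Set.Ioo (0 : ℝ) 1) : y ∈ P.gen x := by
  obtain ⟨d, hxd, hyd⟩ := join_faceStep_of_mk_eq hP h
  rcases hyd.cases_head with rfl | ⟨e, he, -⟩
  · exact mem_gen_of_reflTransGen_faceStep hxd
  · exact absurd he (not_faceStep_of_mem_Ioo hv e)

/-- Distinct open cubes are disjoint in the geometric realisation. -/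
theorem eq_of_pt_eq (hP : P.IsPrecubical) {x y : P.cell}
    {u : Fin (P.deg x) → unitInterval} {v : Fin (P.deg y) → unitInterval}
    (h : P.pt x u = P.pt y v) (hu : ∀ j, (u j : ℝ) ∈ Set.Ioo (0 : ℝ) 1)
    (hv : ∀ j, (v j : ℝ) ∈ Set.Ioo (0 : ℝ) 1) : x = y := by
  rcases eq_or_deg_lt_of_mem_gen hP (mem_gen_of_pt_eq hP h hv) with h1 | h1
  · exact h1.symm
  · rcases eq_or_deg_lt_of_mem_gen hP (mem_gen_of_pt_eq hP h.symm hu) with h2 | h2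
    · exact h2
    · omega

theorem pt_congr {x y : P.cell} (hxy : x = y) {u : Fin (P.deg x) → unitInterval}
    {v : Fin (P.deg y) → unitInterval}
    (h : ∀ j (hx : j < P.deg x) (hy : j < P.deg y), u ⟨j, hx⟩ = v ⟨j, hy⟩) :
    P.pt x u = P.pt y v := by
  subst hxy
  congr 1
  funext j
  exact h j j.2 j.2

end NormalForm

section CharacteristicMap

variable {P : PrecubicalSet}

/-- The face of `y` obtained by collapsing, from the highest direction down, those of the first
`k` directions that are vertices in `g`. -/
def collapse (P : PrecubicalSet) (g : ℕ → ℕ × Bool) : ℕ → P.cell → P.cell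
  | 0, y => y
  | k + 1, y =>
    collapse P g k (if (g k).2 = true then y else P.d (decide ((g k).1 = 1)) (k + 1) y)

/-- The number of edges among the first `k` terms of `g`. -/
def edgeCount (g : ℕ → ℕ × Bool) (k : ℕ) : ℕ := Nat.count (fun i => (g i).2 = true) k

theorem deg_collapse (hP : P.IsPrecubical) (g : ℕ → ℕ × Bool) (k : ℕ) (y : P.cell)
    (hk : k ≤ P.deg y) : P.deg (collapse P g k y) + k = P.deg y + edgeCount g k := by
  induction k generalizing y with
  | zero => simp [collapse, edgeCount]
  | succ k ih =>
    simp only [collapse, edgeCount, Nat.count_succ]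
    by_cases h : (g k).2 = true
    · simp only [h, if_true]
      have := ih y (by omega)
      simp only [edgeCount] at this
      omega
    · simp only [h, if_false, Bool.false_eq_true]
      have hd := hP.1 (decide ((g k).1 = 1)) (k + 1) y (by omega) hk
      have := ih (P.d (decide ((g k).1 = 1)) (k + 1) y) (by omega)
      simp only [edgeCount] at this
      omega

theorem d_collapse (hP : P.IsPrecubical) (g : ℕ → ℕ × Bool) (b : Bool) (k j : ℕ) (y : P.cell)
    (hj : 1 ≤ j) (hk : k + j ≤ P.deg y) :
    P.d b (edgeCount g k + j) (collapse P g k y) = collapse P g k (P.d b (k + j) y) := by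
  induction k generalizing y j with
  | zero => simp [collapse, edgeCount]
  | succ k ih =>
    simp only [collapse]
    by_cases h : (g k).2 = true
    · simp only [h, if_true]
      have := ih (j + 1) y (by omega) (by omega)
      rw [show k + 1 + j = k + (j + 1) by omega, ← this]
      simp only [edgeCount, Nat.count_succ, h, if_true]
      congr 1
      omega
    · simp only [h, if_false, Bool.false_eq_true]
      have hd := hP.1 (decide ((g k).1 = 1)) (k + 1) y (by omega) (by omega)
      rw [hP.2 _ b (k + 1) (k + 1 + j) y (by omega) (by omega) (by omega),
        show k + 1 + j - 1 = k + j by omega, ← ih j _ hj (by omega)]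
      simp [edgeCount, Nat.count_succ, h]

theorem collapse_mem_gen (hP : P.IsPrecubical) (g : ℕ → ℕ × Bool) (k : ℕ) (y : P.cell)
    (hk : k ≤ P.deg y) : collapse P g k y ∈ P.gen y := by
  induction k generalizing y with
  | zero => exact .refl
  | succ k ih =>
    simp only [collapse]
    split_ifs
    · exact ih y (by omega)
    · have hd := hP.1 (decide ((g k).1 = 1)) (k + 1) y (by omega) hk
      exact gen_trans (ih _ (by omega)) (d_mem_gen (by omega) hk)

theorem collapse_of_forall_edge (g : ℕ → ℕ × Bool) (k : ℕ) (y : P.cell)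
    (h : ∀ i < k, (g i).2 = true) : collapse P g k y = y := by
  induction k with
  | zero => rfl
  | succ k ih =>
    simp only [collapse, h k (by omega), if_true]
    exact ih fun i hi => h i (by omega)

theorem collapse_congr {g g' : ℕ → ℕ × Bool} (k : ℕ) (y : P.cell)
    (h : ∀ i < k, g i = g' i) : collapse P g k y = collapse P g' k y := by
  induction k generalizing y with
  | zero => rfl
  | succ k ih =>
    simp only [collapse, h k (by omega)]
    exact ih _ fun i hi => h i (by omega)

/-- Replacing the edge of `g` in direction `p` by a vertex amounts to taking a face. -/
theorem collapse_eq_d_collapse (hP : P.IsPrecubical) {g g' : ℕ → ℕ × Bool} (b : Bool)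
    {p : ℕ} (hp : (g p).2 = true) (hp' : g' p = (if b then 1 else 0, false))
    (hg : ∀ i, i ≠ p → g' i = g i) (n : ℕ) (hn : p < n) (y : P.cell) (hy : n ≤ P.deg y) :
    collapse P g' n y = P.d b (edgeCount g p + 1) (collapse P g n y) := by
  induction n generalizing y with
  | zero => omega
  | succ n ih =>
    by_cases hpn : p = n
    · subst hpn
      simp only [collapse, hp, hp', if_true]
      rw [d_collapse hP g b p 1 y le_rfl hy,
        collapse_congr (g := g') (g' := g) p _ fun i hi => hg i (by omega)]
      cases b <;> simp
    · simp only [collapse, hg n (Ne.symm hpn)]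
      split_ifs
      · exact ih (by omega) y (by omega)
      · have hd := hP.1 (decide ((g n).1 = 1)) (n + 1) y (by omega) hy
        exact ih (by omega) _ (by omega)

/-- A tuple extended to a sequence. -/
def extendTuple {n : ℕ} (c : Fin n → ℕ × Bool) (i : ℕ) : ℕ × Bool :=
  if h : i < n then c ⟨i, h⟩ else (0, false)

theorem extendTuple_val {n : ℕ} (c : Fin n → ℕ × Bool) (i : Fin n) : extendTuple c i = c i := by
  simp [extendTuple]

theorem card_filter_edge_lt {n : ℕ} (c : Fin n → ℕ × Bool) (p : ℕ) :
    (Finset.univ.filter fun i : Fin n => (c i).2 = true ∧ (i : ℕ) < p).card =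
      edgeCount (extendTuple c) p := by
  rw [edgeCount, Nat.count_eq_card_filter_range]
  refine Finset.card_bij (fun i _ => (i : ℕ)) ?_ ?_ ?_
  · intro i hi
    simp only [Finset.mem_filter, Finset.mem_univ, true_and, Finset.mem_range] at hi ⊢
    exact ⟨hi.2, by rw [extendTuple_val]; exact hi.1⟩
  · intro i _ j _ h
    exact Fin.ext h
  · intro i hi
    simp only [Finset.mem_filter, Finset.mem_univ, true_and, Finset.mem_range] at hi ⊢
    have hin : i < n := by
      by_contra hcon
      simp [extendTuple, hcon] at hi
    exact ⟨⟨i, hin⟩, ⟨by simpa [extendTuple, hin] using hi.2, hi.1⟩, rfl⟩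

theorem gridDeg_eq_edgeCount {n : ℕ} (c : Fin n → ℕ × Bool) :
    gridDeg c = edgeCount (extendTuple c) n := by
  rw [← card_filter_edge_lt, gridDeg]
  simp

theorem exists_edge_of_le_gridDeg {n : ℕ} (c : Fin n → ℕ × Bool) {m : ℕ} (h1 : 1 ≤ m)
    (hm : m ≤ gridDeg c) :
    ∃ p : Fin n, (c p).2 = true ∧ edgeCount (extendTuple c) p + 1 = m := by
  rw [gridDeg_eq_edgeCount, edgeCount] at hm
  have hlt : m - 1 < Nat.count (fun i => (extendTuple c i).2 = true) n := by omega
  have hcard : ∀ hf : (Set.ofPred fun i => (extendTuple c i).2 = true).Finite,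
      m - 1 < hf.toFinset.card := fun hf => hlt.trans_le (Nat.count_le_card hf n)
  have hmem := Nat.nth_mem (p := fun i => (extendTuple c i).2 = true) (m - 1) hcard
  have hcount := Nat.count_nth hcard
  have hn : Nat.nth (fun i => (extendTuple c i).2 = true) (m - 1) < n := Nat.nth_lt_of_lt_count hlt
  refine ⟨⟨_, hn⟩, by rw [← extendTuple_val c]; exact hmem, ?_⟩
  rw [edgeCount]
  dsimp only
  omega

/-- The characteristic morphism `x♯ : ⟦0,1⟧^{⊗ deg x} → P` of a cube `x`. -/
def charHom (hP : P.IsPrecubical) (x : P.cell) :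
    PrecubicalHom (BoxData fun _ : Fin (P.deg x) => 1) P where
  map c := collapse P (extendTuple c.1) (P.deg x) x
  deg_map c := by
    have := deg_collapse hP (extendTuple c.1) (P.deg x) x le_rfl
    rw [← gridDeg_eq_edgeCount] at this
    change P.deg (collapse P (extendTuple c.1) (P.deg x) x) = gridDeg c.1
    omega
  d_map b m c h1 hm := by
    obtain ⟨p, hp, rfl⟩ := exists_edge_of_le_gridDeg c.1 h1 hm
    have hcount : ∀ i : Fin (P.deg x),
        (Finset.univ.filter fun i' => (c.1 i').2 = true ∧ i' < i).card =
          edgeCount (extendTuple c.1) i := fun i => card_filter_edge_lt c.1 i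
    have h0 : (c.1 p).1 = 0 := by
      have := c.2 p
      simp only [hp, if_true] at this
      omega
    refine collapse_eq_d_collapse hP b (p := p) ?_ ?_ ?_ _ p.2 x le_rfl
    · rw [extendTuple_val, hp]
    · rw [extendTuple_val]
      change gridD b _ c.1 p = _
      rw [gridD, if_pos ⟨hp, by rw [hcount]⟩, h0, zero_add]
    · intro i hi
      by_cases hin : i < P.deg x
      · simp only [extendTuple, hin, dif_pos]
        change gridD b _ c.1 _ = _
        rw [gridD, if_neg]
        rintro ⟨hc, h⟩
        rw [hcount, Nat.add_right_cancel_iff] at h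
        refine hi (Nat.count_injective (p := fun i => (extendTuple c.1 i).2 = true) ?_ ?_ h)
        · simpa [extendTuple, hin] using hc
        · rw [extendTuple_val, hp]
      · simp [extendTuple, hin]

theorem charHom_map_mem_gen (hP : P.IsPrecubical) (x : P.cell)
    (c : (BoxData fun _ : Fin (P.deg x) => 1).cell) : (charHom hP x).map c ∈ P.gen x :=
  collapse_mem_gen hP _ _ _ le_rfl

end CharacteristicMap

section Realisation

variable {P : PrecubicalSet}

theorem cellOf_val_apply {n : ℕ} (k : Fin n → ℕ) (t : ∀ i, Set.Icc (0 : ℝ) (k i : ℝ))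
    (i : Fin n) : (cellOf k t).1 i = (⌊(t i : ℝ)⌋.toNat, decide ((t i : ℝ) ≠ ⌊(t i : ℝ)⌋)) := by
  change (if (t i : ℝ) = (⌊(t i : ℝ)⌋ : ℤ) then _ else _) = _
  split_ifs with h
  · rw [decide_eq_false (not_not.2 h)]
  · rw [decide_eq_true h]

theorem exists_uOf_eq_fract {n : ℕ} (k : Fin n → ℕ) (t : ∀ i, Set.Icc (0 : ℝ) (k i : ℝ)) :
    ∃ e : Fin ((BoxData k).deg (cellOf k t)) → Fin n, StrictMono e ∧
      (∀ m, ((cellOf k t).1 (e m)).2 = true) ∧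
      ∀ m, (uOf k t m : ℝ) = Int.fract (t (e m) : ℝ) :=
  ⟨(Finset.univ.filter fun i => ((cellOf k t).1 i).2 = true).orderEmbOfFin rfl,
    OrderEmbedding.strictMono _,
    fun m => (Finset.mem_filter.1 (Finset.orderEmbOfFin_mem
      (Finset.univ.filter fun i => ((cellOf k t).1 i).2 = true) rfl m)).2, fun _ => rfl⟩

theorem uOf_mem_Ioo {n : ℕ} (k : Fin n → ℕ) (t : ∀ i, Set.Icc (0 : ℝ) (k i : ℝ))
    (m : Fin ((BoxData k).deg (cellOf k t))) : (uOf k t m : ℝ) ∈ Set.Ioo (0 : ℝ) 1 := by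
  obtain ⟨e, -, he, hu⟩ := exists_uOf_eq_fract k t
  rw [hu]
  refine ⟨lt_of_le_of_ne (Int.fract_nonneg _) fun h => ?_, Int.fract_lt_one _⟩
  have hmem := he m
  rw [cellOf_val_apply] at hmem
  refine of_decide_eq_true hmem ?_
  have := Int.fract_add_floor (t (e m) : ℝ)
  rw [← h, zero_add] at this
  exact this.symm

/-- The midpoint of a cell of a box. -/
def boxMid {n : ℕ} {k : Fin n → ℕ} (c : (BoxData k).cell) : ∀ i, Set.Icc (0 : ℝ) (k i : ℝ) :=
  fun i => ⟨(c.1 i).1 + if (c.1 i).2 = true then 1 / 2 else 0, by split_ifs <;> positivity, by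
    have h : (((c.1 i).1 + (if (c.1 i).2 then 1 else 0) : ℕ) : ℝ) ≤ k i := by
      exact_mod_cast c.2 i
    push_cast at h
    split_ifs at h ⊢ <;> linarith⟩

theorem cellOf_boxMid {n : ℕ} {k : Fin n → ℕ} (c : (BoxData k).cell) :
    cellOf k (boxMid c) = c := by
  refine Subtype.ext (funext fun i => ?_)
  rw [cellOf_val_apply]
  have key : ∀ (j : ℕ) (e : Bool), (⌊(j : ℝ) + if e = true then 1 / 2 else 0⌋.toNat,
      decide (((j : ℝ) + if e = true then 1 / 2 else 0) ≠
        ⌊(j : ℝ) + if e = true then 1 / 2 else 0⌋)) = (j, e) := by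
    rintro j (_ | _)
    · simp
    · have hfl : ⌊(j : ℝ) + 1 / 2⌋ = (j : ℤ) := by
        rw [Int.floor_eq_iff]
        constructor <;> push_cast <;> linarith
      simp only [if_true, hfl]
      simp
  exact key (c.1 i).1 (c.1 i).2

theorem uOf_boxMid {n : ℕ} {k : Fin n → ℕ} (c : (BoxData k).cell)
    (m : Fin ((BoxData k).deg (cellOf k (boxMid c)))) : uOf k (boxMid c) m = half := by
  obtain ⟨e, -, he, hu⟩ := exists_uOf_eq_fract k (boxMid c)
  have hmem := he m
  rw [cellOf_boxMid] at hmem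
  refine Subtype.ext ((hu m).trans ?_)
  simp only [boxMid]
  rw [if_pos hmem, Int.fract_natCast_add, Int.fract_eq_self.2 (by norm_num)]
  rfl

theorem realBox_boxMid {n : ℕ} {k : Fin n → ℕ} (ξ : PrecubicalHom (BoxData k) P)
    (c : (BoxData k).cell) : realBox ξ (boxMid c) = P.pt (ξ.map c) fun _ => half :=
  pt_congr (congrArg ξ.map (cellOf_boxMid c)) fun _ _ _ => uOf_boxMid c _

theorem realBox_charHom (hP : P.IsPrecubical) (x : P.cell) (u : Fin (P.deg x) → unitInterval)
    (hu : ∀ j, (u j : ℝ) ∈ Set.Ioo (0 : ℝ) 1) :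
    realBox (charHom hP x)
      (fun i => ⟨(u i : ℝ), (u i).2.1, by simpa using (u i).2.2⟩) = P.pt x u := by
  set t : ∀ i : Fin (P.deg x), Set.Icc (0 : ℝ) (((fun _ => 1 : Fin (P.deg x) → ℕ) i : ℕ) : ℝ) :=
    fun i => ⟨(u i : ℝ), (u i).2.1, by simpa using (u i).2.2⟩
  have hedge : ∀ i, ((cellOf _ t).1 i).2 = true := by
    intro i
    have hfl : ⌊(t i : ℝ)⌋ = 0 := Int.floor_eq_zero_iff.2 ⟨(hu i).1.le, (hu i).2⟩
    rw [cellOf_val_apply, hfl]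
    refine decide_eq_true ?_
    rw [Int.cast_zero]
    exact (hu i).1.ne'
  have hmap : (charHom hP x).map (cellOf _ t) = x := by
    refine collapse_of_forall_edge _ _ _ fun i hi => ?_
    simpa [extendTuple, hi] using hedge ⟨i, hi⟩
  refine pt_congr hmap fun j h1 h2 => ?_
  obtain ⟨e, hmono, -, hfract⟩ := exists_uOf_eq_fract _ t
  have hdeg : (BoxData fun _ : Fin (P.deg x) => 1).deg (cellOf _ t) = P.deg x := by
    rw [← (charHom hP x).deg_map, hmap]
  have hcard : (Finset.univ : Finset (Fin (P.deg x))).card =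
      (BoxData fun _ => 1).deg (cellOf _ t) := by
    rw [hdeg, Finset.card_univ, Fintype.card_fin]
  have he : e = Fin.cast hdeg :=
    (Finset.orderEmbOfFin_unique hcard (fun _ => Finset.mem_univ _) hmono).trans
      (Finset.orderEmbOfFin_unique hcard (fun _ => Finset.mem_univ _) fun _ _ h => h).symm
  refine Subtype.ext ((hfract _).trans ?_)
  rw [he]
  exact Int.fract_eq_self.2 ⟨(hu _).1.le, (hu _).2⟩

end Realisation

section Carrier

variable {P Q : PrecubicalSet}

theorem half_mem_Ioo : (half : ℝ) ∈ Set.Ioo (0 : ℝ) 1 := by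
  norm_num [half]

/-- The carrier of a face of `a` is an iterated face of the carrier of `a`. -/
theorem IsCarrier.mem_gen_of_d (hP : P.IsPrecubical) (hQ : Q.IsPrecubical)
    {f : P.GeomReal → Q.GeomReal} (hf : IsWeakMorphism f) (hinj : Function.Injective f)
    {a : Q.cell} {p q : P.cell} (hp : IsCarrier f p a) {b : Bool} {i : ℕ} (h1 : 1 ≤ i)
    (hi : i ≤ Q.deg a) (hq : IsCarrier f q (Q.d b i a)) : q ∈ P.gen p := by
  obtain ⟨u, hu, hfu⟩ := hp
  obtain ⟨v, hv, hfv⟩ := hq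
  obtain ⟨l, -, χ, φ, -, hφ⟩ := hf.2 (P.deg p) (fun _ => 1) (fun _ => le_rfl) (charHom hP p)
  have hpt := hφ (fun i => ⟨(u i : ℝ), (u i).2.1, by simpa using (u i).2.2⟩)
  rw [realBox_charHom hP p u hu, hfu] at hpt
  generalize φ _ = t at hpt
  have ha : a = χ.map (cellOf l t) :=
    eq_of_pt_eq hQ hpt (fun _ => half_mem_Ioo) fun _ => uOf_mem_Ioo l t _
  subst ha
  rw [χ.deg_map] at hi
  have hmid := hφ (φ.symm (boxMid ((BoxData l).d b i (cellOf l t))))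
  rw [φ.apply_symm_apply, realBox_boxMid] at hmid
  have hface : Q.pt (χ.map ((BoxData l).d b i (cellOf l t))) (fun _ => half) =
      Q.pt (Q.d b i (χ.map (cellOf l t))) fun _ => half :=
    pt_congr (χ.d_map b i _ h1 hi) fun _ _ _ => rfl
  have heq := hinj (hmid.trans (hface.trans hfv.symm))
  exact gen_trans (mem_gen_of_pt_eq hP heq hv) (charHom_map_mem_gen hP p _)

end Carrier

end PrecubicalSet

open PrecubicalSet in
/-- Let `f : |P| → |Q|` be a weak morphism of precubical sets
that is a homeomorphism, with carrier function `c`, let `A ⊆ Q` be a precubical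
subset, and `z` a top cube of `c(A)`. Then `A⁻_z = {a ∈ A | c(a) ≠ z}` is a
precubical subset of `A`, and `z ∉ c(A⁻_z)`. -/
theorem sub_minus_top_cube (P Q : PrecubicalSet)
    (hP : P.IsPrecubical) (hQ : Q.IsPrecubical)
    (f : P.GeomReal ≃ₜ Q.GeomReal) (hf : IsWeakMorphism (P := P) (Q := Q) f)
    (c : Q.cell → P.cell) (hc : ∀ a, IsCarrier (P := P) (Q := Q) f (c a) a)
    (A : Set Q.cell) (hA : Q.IsSub A)
    (z : P.cell) (hz : TopCube P (carrierSet c A) z) :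
    Q.IsSub {a ∈ A | c a ≠ z} ∧ {a ∈ A | c a ≠ z} ⊆ A ∧
      z ∉ carrierSet c {a ∈ A | c a ≠ z} := by
  have hnot : ∀ a ∈ A, c a ≠ z → z ∉ P.gen (c a) := by
    intro a ha hne hmem
    rcases eq_or_deg_lt_of_mem_gen hP hmem with h | h
    · exact hne h.symm
    · exact hz.2 (c a) ⟨a, ha, .refl⟩ h hmem
  refine ⟨?_, fun a ha => ha.1, ?_⟩
  · rintro b i a h1 hi ⟨ha, hne⟩
    refine ⟨hA b i a h1 hi ha, ?_⟩
    rintro rfl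
    exact hnot a ha hne ((hc a).mem_gen_of_d hP hQ hf f.injective h1 hi (hc _))
  · rintro ⟨a, ⟨ha, hne⟩, hmem⟩
    exact hnot a ha hne hmem
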